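/- arXiv:1411.4985 — 4 statements merged into one kernel-verified Lean document; each statement's English description precedes it below -/
import Mathlib

section
/- Let V be a finite-dimensional real normed vector space, W an open neighborhood of 0 in V, τ : V → ℝ a function that is C^∞ on W, k a positive integer and C > 0 a constant such that |τ(v)| ≤ C·‖v‖^k for all v ∈ W. Then for every w ∈ V, the function r ↦ τ(r•w)/r^k tends, as r → 0 from the right, to (1/k!)·(iteratedFDeriv ℝ k τ 0)(w, …, w), the k-th derivative of τ at 0 evaluated on k copies of w divided by k!. -/
theorem aux_tendsto {g : ℝ → ℝ} {s : Set ℝ} (hs : Convex ℝ s) (ho : IsOpen s) (h0 : (0:ℝ) ∈ s)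
    (n : ℕ) (hg : ContDiffOn ℝ n g s) (hz : ∀ j < n, iteratedDerivWithin j g s 0 = 0) :
    Filter.Tendsto (fun r : ℝ => g r / r ^ n) (nhdsWithin 0 (Set.Ioi 0))
      (nhds ((n.factorial : ℝ)⁻¹ * iteratedDerivWithin n g s 0)) := by
  have h := Real.taylor_tendsto hs h0 hg
  rw [ho.nhdsWithin_eq h0] at h
  have h2 := (h.mono_left (nhdsWithin_le_nhds (s := Set.Ioi 0))).add_const
    ((n.factorial : ℝ)⁻¹ * iteratedDerivWithin n g s 0)
  rw [zero_add] at h2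
  refine h2.congr' ?_
  filter_upwards [self_mem_nhdsWithin] with r hr
  have hr : r ≠ 0 := ne_of_gt hr
  rw [taylor_within_apply, Finset.sum_range_succ, Finset.sum_eq_zero]
  · simp only [sub_zero, zero_add, smul_eq_mul]
    field_simp
    ring
  · intro j hj
    rw [hz j (Finset.mem_range.1 hj), smul_zero]

theorem aux_zero {g : ℝ → ℝ} {s : Set ℝ} (hs : Convex ℝ s) (ho : IsOpen s) (h0 : (0:ℝ) ∈ s)
    (k : ℕ) (hg : ContDiffOn ℝ k g s) (D : ℝ) (hb : ∀ r ∈ s, |g r| ≤ D * |r| ^ k) :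
    ∀ j < k, iteratedDerivWithin j g s 0 = 0 := by
  intro j
  induction j using Nat.strong_induction_on with
  | _ j ih =>
    intro hj
    have h1 := aux_tendsto hs ho h0 j (hg.of_le (by exact_mod_cast hj.le))
      (fun i hi => ih i hi (hi.trans hj))
    have h2 : Filter.Tendsto (fun r : ℝ => g r / r ^ j) (nhdsWithin 0 (Set.Ioi 0)) (nhds 0) := by
      have h3 : Filter.Tendsto (fun r : ℝ => D * |r| ^ (k - j)) (nhdsWithin 0 (Set.Ioi 0))
          (nhds 0) := by
        have : Continuous (fun r : ℝ => D * |r| ^ (k - j)) := by fun_prop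
        have h4 := this.tendsto 0
        simp only [abs_zero, zero_pow (Nat.sub_ne_zero_of_lt hj), mul_zero] at h4
        exact h4.mono_left nhdsWithin_le_nhds
      refine squeeze_zero_norm' ?_ h3
      filter_upwards [self_mem_nhdsWithin, nhdsWithin_le_nhds (ho.mem_nhds h0)] with r hr hrs
      have hr : 0 < r := hr
      have := hb r hrs
      rw [Real.norm_eq_abs, abs_div, abs_pow, div_le_iff₀ (by positivity), mul_assoc, ← pow_add,
        Nat.sub_add_cancel hj.le]
      exact this
    have h5 := tendsto_nhds_unique h1 h2
    have : ((j.factorial : ℝ)⁻¹) ≠ 0 := by positivity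
    exact (mul_eq_zero.1 h5).resolve_left this


/-- If a function `τ` is smooth on a neighborhood `W` of `0` in a finite-dimensional real
normed vector space and satisfies `|τ v| ≤ C * ‖v‖ ^ k` on `W`, then for each `w`, the
renormalized function `r ↦ τ (r • w) / r ^ k` tends, as `r → 0⁺`, to
`(1/k!) · D^k τ(0)(w, …, w)`. -/
theorem stmt_1 {V : Type*} [NormedAddCommGroup V] [NormedSpace ℝ V] [FiniteDimensional ℝ V]
    (W : Set V) (hW : IsOpen W) (h0W : (0 : V) ∈ W)
    (τ : V → ℝ) (hτ : ContDiffOn ℝ (⊤ : ℕ∞) τ W)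
    (k : ℕ) (hk : 1 ≤ k) (C : ℝ) (hC : 0 < C)
    (hbd : ∀ v ∈ W, |τ v| ≤ C * ‖v‖ ^ k) :
    ∀ w : V,
      Filter.Tendsto (fun r : ℝ => τ (r • w) / r ^ k)
        (nhdsWithin 0 (Set.Ioi 0))
        (nhds ((k.factorial : ℝ)⁻¹ * iteratedFDeriv ℝ k τ 0 (fun _ => w))) := by
  intro w
  let L : ℝ →L[ℝ] V := ContinuousLinearMap.toSpanSingleton ℝ w
  have hL : ∀ r, L r = r • w := fun r => by simp [L]
  have hpo : IsOpen (L ⁻¹' W) := hW.preimage L.continuous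
  have h0p : (0 : ℝ) ∈ L ⁻¹' W := by simpa using h0W
  obtain ⟨δ, hδ, hsub⟩ := Metric.isOpen_iff.1 hpo 0 h0p
  have h0 : (0 : ℝ) ∈ Metric.ball (0 : ℝ) δ := Metric.mem_ball_self hδ
  have hτk : ContDiffOn ℝ k τ W := hτ.of_le (by exact_mod_cast le_top)
  have hg : ContDiffOn ℝ k (τ ∘ L) (L ⁻¹' W) := hτk.comp_continuousLinearMap L
  have hgs := hg.mono hsub
  have key : iteratedDerivWithin k (τ ∘ L) (Metric.ball (0 : ℝ) δ) 0
      = iteratedFDeriv ℝ k τ 0 (fun _ => w) := by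
    rw [iteratedDerivWithin_eq_iteratedFDerivWithin,
      iteratedFDerivWithin_of_isOpen k Metric.isOpen_ball h0,
      ← iteratedFDerivWithin_of_isOpen k hpo h0p,
      L.iteratedFDerivWithin_comp_right hτk hW.uniqueDiffOn hpo.uniqueDiffOn h0p le_rfl,
      iteratedFDerivWithin_of_isOpen k hW h0p]
    simp [hL]
  have hz := aux_zero (convex_ball (0 : ℝ) δ) Metric.isOpen_ball h0 k hgs (C * ‖w‖ ^ k) (by
    intro r hr
    have := hbd _ (hsub hr)
    rw [hL, norm_smul, mul_pow, Real.norm_eq_abs] at this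
    rw [Function.comp_apply, hL]
    linarith)
  have := aux_tendsto (convex_ball (0 : ℝ) δ) Metric.isOpen_ball h0 k hgs hz
  rw [key] at this
  simpa only [Function.comp_apply, hL] using this
end

section
/- Let V be a finite-dimensional real normed vector space, W an open neighborhood of 0 in V, τ : V → ℝ a function that is C^∞ on W, k a positive integer and C > 0 a constant such that |τ(v)| ≤ C·‖v‖^k for all v ∈ W. Then there exists a function F : ℝ × V → ℝ which is C^∞ on the open set {(r, w) ∈ ℝ × V : r•w ∈ W}, such that F(r, w) = τ(r•w)/r^k whenever r > 0 and r•w ∈ W, and F(0, w) = (1/k!)·(iteratedFDeriv ℝ k τ 0)(w, …, w) for every w ∈ V. -/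
open Set Filter Topology MeasureTheory

lemma aux_hasFDerivAt {X : Type*} [NormedAddCommGroup X] [NormedSpace ℝ X] [FiniteDimensional ℝ X]
    (G : X × ℝ → ℝ) (hG : ContDiff ℝ (⊤ : ℕ∞) G) (x₀ : X) :
    HasFDerivAt (fun x => ∫ t in (0:ℝ)..1, G (x, t))
      (∫ t in (0:ℝ)..1, (fderiv ℝ G (x₀, t)).comp (ContinuousLinearMap.inl ℝ X ℝ)) x₀ := by
  have hc : Continuous G := hG.continuous
  have hd : Continuous (fun p : X × ℝ =>
      (fderiv ℝ G p).comp (ContinuousLinearMap.inl ℝ X ℝ)) :=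
    (hG.continuous_fderiv (by simp)).clm_comp continuous_const
  have : ProperSpace X := FiniteDimensional.proper ℝ X
  obtain ⟨M, hM⟩ := ((isCompact_closedBall x₀ 1).prod (isCompact_Icc (a := (0:ℝ)) (b := 1))).exists_bound_of_continuousOn
    hd.continuousOn
  refine intervalIntegral.hasFDerivAt_integral_of_dominated_of_fderiv_le
    (F := fun x t => G (x, t))
    (F' := fun x t => (fderiv ℝ G (x, t)).comp (ContinuousLinearMap.inl ℝ X ℝ))
    (bound := fun _ => M) (s := Metric.closedBall x₀ 1)
    (Metric.closedBall_mem_nhds x₀ one_pos) ?_ ?_ ?_ ?_ ?_ ?_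
  · exact Eventually.of_forall fun x =>
      (hc.comp (Continuous.prodMk_right x)).aestronglyMeasurable
  · exact (hc.comp (Continuous.prodMk_right x₀)).intervalIntegrable _ _
  · exact (hd.comp (Continuous.prodMk_right x₀)).aestronglyMeasurable
  · refine Eventually.of_forall fun t ht x hx => hM (x, t) ⟨hx, ?_⟩
    rw [uIoc_of_le zero_le_one] at ht
    exact ⟨ht.1.le, ht.2⟩
  · exact intervalIntegrable_const
  · refine Eventually.of_forall fun t ht x hx => ?_
    have h1 : HasFDerivAt G (fderiv ℝ G (x, t)) (x, t) :=
      (hG.differentiable (by simp) _).hasFDerivAt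
    exact h1.comp x (hasFDerivAt_prodMk_left x t)

lemma aux_contDiff_nat {X : Type*} [NormedAddCommGroup X] [NormedSpace ℝ X] [FiniteDimensional ℝ X]
    (n : ℕ) : ∀ (G : X × ℝ → ℝ), ContDiff ℝ (⊤ : ℕ∞) G →
    ContDiff ℝ n (fun x => ∫ t in (0:ℝ)..1, G (x, t)) := by
  induction n with
  | zero =>
    intro G hG
    have : Differentiable ℝ (fun x => ∫ t in (0:ℝ)..1, G (x, t)) :=
      fun x => (aux_hasFDerivAt G hG x).differentiableAt
    exact contDiff_zero.2 this.continuous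
  | succ n ih =>
    intro G hG
    push_cast
    rw [contDiff_succ_iff_fderiv_apply]
    refine ⟨fun x => (aux_hasFDerivAt G hG x).differentiableAt, by simp, fun y => ?_⟩
    have h := ih (fun p => fderiv ℝ G p (y, 0))
      ((hG.fderiv_right (m := (⊤ : ℕ∞)) (by simp)).clm_apply contDiff_const)
    convert h using 2 with x
    rw [(aux_hasFDerivAt G hG x).fderiv, ContinuousLinearMap.intervalIntegral_apply]
    · simp
    · refine Continuous.intervalIntegrable ?_ _ _
      exact (((hG.continuous_fderiv (by simp)).comp (Continuous.prodMk_right x)).clm_comp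
        continuous_const)

lemma aux_hadamard {V : Type*} [NormedAddCommGroup V] [NormedSpace ℝ V] [FiniteDimensional ℝ V]
    (f : ℝ × V → ℝ) (hf : ContDiff ℝ (⊤ : ℕ∞) f) (h0 : ∀ w, f (0, w) = 0) :
    ∃ g : ℝ × V → ℝ, ContDiff ℝ (⊤ : ℕ∞) g ∧ ∀ r w, f (r, w) = r * g (r, w) := by
  refine ⟨fun p => ∫ t in (0:ℝ)..1, fderiv ℝ f (t * p.1, p.2) (1, 0), ?_, ?_⟩
  · refine contDiff_infty.2 fun n => aux_contDiff_nat n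
      (fun q : (ℝ × V) × ℝ => fderiv ℝ f (q.2 * q.1.1, q.1.2) (1, 0)) ?_
    refine ContDiff.clm_apply (ContDiff.comp (hf.fderiv_right (m := (⊤ : ℕ∞)) (by simp)) ?_)
      contDiff_const
    fun_prop
  · intro r w
    have hder : ∀ t ∈ uIcc (0:ℝ) 1, HasDerivAt (fun t : ℝ => f (t * r, w))
        (r * fderiv ℝ f (t * r, w) (1, 0)) t := by
      intro t _
      have h1 : HasFDerivAt f (fderiv ℝ f (t * r, w)) (t * r, w) :=
        (hf.differentiable (by simp) _).hasFDerivAt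
      have h2 : HasDerivAt (fun t : ℝ => (t * r, w)) (1 * r, 0) t :=
        ((hasDerivAt_id t).mul_const r).prodMk (hasDerivAt_const t w)
      have h3 := h1.comp_hasDerivAt t h2
      have e : fderiv ℝ f (t * r, w) (1 * r, 0) = r * fderiv ℝ f (t * r, w) (1, 0) := by
        rw [← smul_eq_mul r, ← map_smul]
        simp
      rw [e] at h3
      exact h3
    have hcont : Continuous (fun t : ℝ => r * fderiv ℝ f (t * r, w) (1, 0)) := by
      have := hf.continuous_fderiv (by simp)
      fun_prop
    have := intervalIntegral.integral_eq_sub_of_hasDerivAt hder (hcont.intervalIntegrable _ _)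
    simp only [intervalIntegral.integral_const_mul, one_mul, zero_mul, h0, sub_zero] at this
    exact this.symm

lemma aux_iteratedDeriv (k : ℕ) : ∀ (g : ℝ → ℝ), ContDiff ℝ (⊤ : ℕ∞) g →
    iteratedDeriv k (fun r => r ^ k * g r) 0 = k.factorial * g 0 := by
  induction k with
  | zero => intro g _; simp
  | succ k ih =>
    intro g hg
    rw [iteratedDeriv_succ']
    have hg' : ContDiff ℝ (⊤ : ℕ∞) (deriv g) := (contDiff_infty_iff_deriv.1 hg).2
    have : deriv (fun r : ℝ => r ^ (k+1) * g r)
        = fun r => r ^ k * ((k + 1 : ℝ) * g r + r * deriv g r) := by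
      ext r
      have h1 : HasDerivAt g (deriv g r) r := (hg.differentiable (by simp) r).hasDerivAt
      refine ((hasDerivAt_pow (k+1) r).mul h1).deriv.trans ?_
      simp
      ring
    rw [this, ih _ (by fun_prop)]
    simp [Nat.factorial_succ]
    ring

lemma aux_iter {V : Type*} [NormedAddCommGroup V] [NormedSpace ℝ V] [FiniteDimensional ℝ V]
    (f : ℝ × V → ℝ) (hf : ContDiff ℝ (⊤ : ℕ∞) f) (k : ℕ) (C : V → ℝ)
    (hb : ∀ r w, |f (r, w)| ≤ C w * |r| ^ k) (j : ℕ) (hj : j ≤ k) :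
    ∃ g : ℝ × V → ℝ, ContDiff ℝ (⊤ : ℕ∞) g ∧ ∀ r w, f (r, w) = r ^ j * g (r, w) := by
  induction j with
  | zero => exact ⟨f, hf, by simp⟩
  | succ j ih =>
    obtain ⟨g, hg, hfg⟩ := ih (by omega)
    have h0 : ∀ w, g (0, w) = 0 := by
      intro w
      have hgc : Continuous fun r : ℝ => |g (r, w)| :=
        (hg.continuous.comp (Continuous.prodMk_left w)).abs
      have h1 : Tendsto (fun r : ℝ => |g (r, w)|) (𝓝[≠] 0) (𝓝 |g (0, w)|) :=
        hgc.continuousAt.tendsto.mono_left nhdsWithin_le_nhds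
      have hcc : Continuous fun r : ℝ => C w * |r| ^ (k - j) := by fun_prop
      have h2 : Tendsto (fun r : ℝ => C w * |r| ^ (k - j)) (𝓝[≠] 0) (𝓝 0) := by
        have := hcc.tendsto 0
        rw [abs_zero, zero_pow (by omega), mul_zero] at this
        exact this.mono_left nhdsWithin_le_nhds
      have h3 : |g (0, w)| ≤ 0 := by
        refine le_of_tendsto_of_tendsto h1 h2 ?_
        filter_upwards [self_mem_nhdsWithin] with r hr
        have hr' : 0 < |r| := abs_pos.2 hr
        have := hb r w
        rw [hfg, abs_mul, abs_pow] at this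
        have e : |r| ^ k = |r| ^ j * |r| ^ (k - j) := by rw [← pow_add]; congr 1; omega
        rw [e] at this
        have hp : 0 < |r| ^ j := by positivity
        refine le_of_mul_le_mul_left ?_ hp
        linarith
      exact abs_nonpos_iff.1 h3
    obtain ⟨g', hg', h'⟩ := aux_hadamard g hg h0
    exact ⟨g', hg', fun r w => by rw [hfg, h']; ring⟩

/-- The renormalized function extends smoothly to the boundary of the spherical blowup,
in polar variables: there is `F : ℝ × V → ℝ`, smooth on `{(r, w) | r • w ∈ W}`, with
`F (r, w) = τ (r • w) / r ^ k` for `r > 0` (with `r • w ∈ W`), and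
`F (0, w) = (1/k!) · D^k τ(0)(w, …, w)`. -/
theorem stmt_2 {V : Type*} [NormedAddCommGroup V] [NormedSpace ℝ V] [FiniteDimensional ℝ V]
    (W : Set V) (hW : IsOpen W) (h0W : (0 : V) ∈ W)
    (τ : V → ℝ) (hτ : ContDiffOn ℝ (⊤ : ℕ∞) τ W)
    (k : ℕ) (hk : 1 ≤ k) (C : ℝ) (hC : 0 < C)
    (hbd : ∀ v ∈ W, |τ v| ≤ C * ‖v‖ ^ k) :
    ∃ F : ℝ × V → ℝ,
      ContDiffOn ℝ (⊤ : ℕ∞) F {p : ℝ × V | p.1 • p.2 ∈ W} ∧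
      (∀ r : ℝ, ∀ w : V, 0 < r → r • w ∈ W → F (r, w) = τ (r • w) / r ^ k) ∧
      (∀ w : V, F (0, w) = (k.factorial : ℝ)⁻¹ * iteratedFDeriv ℝ k τ 0 (fun _ => w)) := by
  obtain ⟨ε, hε, hεW⟩ := Metric.isOpen_iff.1 hW 0 h0W
  let χ : ContDiffBump (0 : V) := ⟨ε / 4, ε / 2, by positivity, by linarith⟩
  have hsupp : tsupport χ ⊆ W := by
    rw [χ.tsupport_eq]
    refine (Metric.closedBall_subset_ball ?_).trans hεW
    change ε / 2 < ε
    linarith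
  let σ : V → ℝ := fun v => χ v * τ v
  have hσ : ContDiff ℝ (⊤ : ℕ∞) σ := by
    rw [contDiff_iff_contDiffAt]
    intro v
    by_cases hv : v ∈ W
    · exact χ.contDiff.contDiffAt.mul (hτ.contDiffAt (hW.mem_nhds hv))
    · have h1 : v ∉ tsupport χ := fun h => hv (hsupp h)
      have h2 : (χ : V → ℝ) =ᶠ[𝓝 v] 0 := notMem_tsupport_iff_eventuallyEq.1 h1
      have h3 : σ =ᶠ[𝓝 v] fun _ => 0 := by
        filter_upwards [h2] with x hx
        simp [σ, hx]
      exact contDiffAt_const.congr_of_eventuallyEq h3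
  have hστ : τ =ᶠ[𝓝 0] σ := by
    filter_upwards [χ.eventuallyEq_one] with x hx
    simp [σ, hx]
  have hσb : ∀ v, |σ v| ≤ C * ‖v‖ ^ k := by
    intro v
    by_cases hv : v ∈ W
    · refine le_trans ?_ (hbd v hv)
      simp only [σ, abs_mul]
      refine mul_le_of_le_one_left (abs_nonneg _) ?_
      rw [abs_of_nonneg χ.nonneg]
      exact χ.le_one
    · have h1 : χ v = 0 := image_eq_zero_of_notMem_tsupport fun h => hv (hsupp h)
      simp only [σ, h1, zero_mul, abs_zero]
      positivity
  obtain ⟨g, hg, hfg⟩ := aux_iter (fun p : ℝ × V => σ (p.1 • p.2))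
    (hσ.comp (contDiff_fst.smul contDiff_snd)) k (fun w => C * ‖w‖ ^ k) (by
      intro r w
      refine (hσb _).trans_eq ?_
      rw [norm_smul, mul_pow, Real.norm_eq_abs]
      ring) k le_rfl
  simp only at hfg
  refine ⟨fun p => if p.1 = 0 then g p else τ (p.1 • p.2) / p.1 ^ k, ?_, ?_, ?_⟩
  · rintro ⟨r, w⟩ hp
    refine ContDiffAt.contDiffWithinAt ?_
    by_cases hr : r = 0
    · subst hr
      refine hg.contDiffAt.congr_of_eventuallyEq ?_
      have ht : Tendsto (fun p : ℝ × V => p.1 • p.2) (𝓝 (0, w)) (𝓝 0) := by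
        have : Continuous fun p : ℝ × V => p.1 • p.2 := by fun_prop
        simpa using this.tendsto (0, w)
      filter_upwards [ht.eventually hστ] with p hp
      by_cases h : p.1 = 0
      · simp [h]
      · simp only [h, if_false]
        rw [hp, hfg p.1 p.2, mul_div_cancel_left₀ _ (pow_ne_zero _ h)]
    · have h1 : ContDiffAt ℝ (⊤ : ℕ∞) (fun p : ℝ × V => τ (p.1 • p.2) / p.1 ^ k) (r, w) := by
        refine ContDiffAt.div ?_ (contDiff_fst.pow k).contDiffAt (pow_ne_zero _ hr)
        exact ContDiffAt.comp (r, w) (g := τ) (hτ.contDiffAt (hW.mem_nhds hp))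
          (contDiff_fst.smul contDiff_snd).contDiffAt
      refine h1.congr_of_eventuallyEq ?_
      have : ∀ᶠ p : ℝ × V in 𝓝 (r, w), p.1 ≠ 0 :=
        continuous_fst.continuousAt.eventually_ne hr
      filter_upwards [this] with p hp
      simp [hp]
  · intro r w hr _
    simp [hr.ne']
  · intro w
    simp only [if_true]
    rw [(hστ.iteratedFDeriv (𝕜 := ℝ) k).self_of_nhds]
    have h1 := aux_iteratedDeriv k (fun r => g (r, w))
      (hg.comp (contDiff_id.prodMk contDiff_const))
    simp only [← hfg] at h1
    have h2 := (ContinuousLinearMap.toSpanSingleton ℝ w).iteratedFDeriv_comp_right hσ 0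
      (i := k) (by exact_mod_cast le_top)
    have h3 : iteratedDeriv k (fun r : ℝ => σ (r • w)) 0 = iteratedFDeriv ℝ k σ 0 (fun _ => w) := by
      rw [iteratedDeriv_eq_iteratedFDeriv]
      have : (fun r : ℝ => σ (r • w)) = σ ∘ (ContinuousLinearMap.toSpanSingleton ℝ w) := by
        ext r; simp
      rw [this, h2]
      simp
    rw [← h3, h1, inv_mul_cancel_left₀ (by positivity)]
end

section
/- Let V' and V'' be complex inner product spaces, B a real normed vector space, U ⊆ B open, and f : U → ℝ a C^1 function such that for every b ∈ U with f(b) = 0 the derivative fderiv ℝ f b is nonzero (f is a submersion at its zeros). Define m : V' × V'' × U → ℝ by m(y', y'', b) = (1/2)·(‖y'‖² − ‖y''‖²) + f(b). Then for every point p = (y', y'', b) with m(p) = 0, the derivative of m at p is a nonzero (hence surjective) linear map to ℝ; in particular the zero set of m is contained in the set of regular points of m. -/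
/-- If `f` is a submersion at each of its zeros in `U`, then the fiberwise moment map
`m (y', y'', b) = (1/2)(‖y'‖² − ‖y''‖²) + f b` is a submersion at each of its zeros: its
derivative there is a nonzero linear functional. -/
theorem stmt_8 {V₁ V₂ B : Type*} [NormedAddCommGroup V₁] [InnerProductSpace ℂ V₁]
    [NormedAddCommGroup V₂] [InnerProductSpace ℂ V₂]
    [NormedAddCommGroup B] [NormedSpace ℝ B]
    (U : Set B) (hU : IsOpen U)
    (f : B → ℝ) (hf : ContDiffOn ℝ 1 f U)
    (hsub : ∀ b ∈ U, f b = 0 → fderiv ℝ f b ≠ 0)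
    (m : V₁ × V₂ × B → ℝ)
    (hm : ∀ p : V₁ × V₂ × B, m p = (1 / 2) * (‖p.1‖ ^ 2 - ‖p.2.1‖ ^ 2) + f p.2.2) :
    ∀ p : V₁ × V₂ × B, p.2.2 ∈ U → m p = 0 → fderiv ℝ m p ≠ 0 := by
  let _ : InnerProductSpace ℝ V₁ := InnerProductSpace.rclikeToReal ℂ V₁
  let _ : InnerProductSpace ℝ V₂ := InnerProductSpace.rclikeToReal ℂ V₂
  intro p hp hmp h0
  have hfd : HasFDerivAt f (fderiv ℝ f p.2.2) p.2.2 :=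
    ((hf.contDiffAt (hU.mem_nhds hp)).differentiableAt one_ne_zero).hasFDerivAt
  have e1 : HasFDerivAt (fun q : V₁ × V₂ × B => q.1) (ContinuousLinearMap.fst ℝ V₁ (V₂ × B)) p :=
    hasFDerivAt_fst
  have e2' : HasFDerivAt (fun q : V₁ × V₂ × B => q.2) (ContinuousLinearMap.snd ℝ V₁ (V₂ × B)) p :=
    hasFDerivAt_snd
  have e2 : HasFDerivAt (fun q : V₁ × V₂ × B => q.2.1)
      ((ContinuousLinearMap.fst ℝ V₂ B).comp (ContinuousLinearMap.snd ℝ V₁ (V₂ × B))) p :=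
    e2'.fst
  have e3 : HasFDerivAt (fun q : V₁ × V₂ × B => q.2.2)
      ((ContinuousLinearMap.snd ℝ V₂ B).comp (ContinuousLinearMap.snd ℝ V₁ (V₂ × B))) p :=
    e2'.snd
  have n1 := ((hasStrictFDerivAt_norm_sq p.1).hasFDerivAt).comp p e1
  have n2 := ((hasStrictFDerivAt_norm_sq p.2.1).hasFDerivAt).comp p e2
  have n3 := hfd.comp p e3
  have H := (((n1.sub n2).const_mul (1 / 2 : ℝ)).add n3)
  have H' := H.congr_of_eventuallyEq (f₁ := m) (Filter.Eventually.of_forall hm)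
  rw [H'.fderiv] at h0
  have hv := fun v => DFunLike.congr_fun h0 v
  have h1 : p.1 = 0 := by
    have := hv (p.1, 0, 0)
    simpa using this
  have h2 : p.2.1 = 0 := by
    have := hv (0, p.2.1, 0)
    simpa using this
  have h3 : f p.2.2 = 0 := by
    rw [hm, h1, h2] at hmp
    simpa using hmp
  apply hsub _ hp h3
  ext b
  have := hv (0, 0, b)
  simpa using this
end

section
/- Let V' and V'' be complex inner product spaces. For ζ ∈ ℂ with ζ ≠ 0, r ∈ ℝ, and (w', w'') ∈ V' × V'' with ‖w'‖² + ‖w''‖² = 1, define N(ζ, w', w'') = (|ζ|²·‖w'‖² + |ζ|⁻²·‖w''‖²)^{1/2} (which is strictly positive) and ζ · (r, (w', w'')) := ( r·N(ζ, w', w''), N(ζ, w', w'')⁻¹ · (ζ w', ζ⁻¹ w'') ). Then this formula defines a group action of the units ℂ* on ℝ × S(V'⊕V''), where S(V'⊕V'') is the unit sphere of V' × V'': one has 1·(r, w) = (r, w), the second component again lies on the unit sphere, and ζ₁·(ζ₂·(r, w)) = (ζ₁ζ₂)·(r, w) for all ζ₁, ζ₂ ∈ ℂ*; moreover for r > 0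 this action is compatible with the ℂ*-action ζ·(y', y'') = (ζ y', ζ⁻¹ y'') under the map (r, (w', w'')) ↦ (r w', r w''), i.e. the image of ζ·(r, w) is ζ·(r w', r w''). -/
/-- The normalizing factor `N(ζ, w) = (|ζ|² ‖w'‖² + |ζ|⁻² ‖w''‖²)^{1/2}`. -/
noncomputable def sphereN {V₁ V₂ : Type*} [NormedAddCommGroup V₁] [NormedAddCommGroup V₂]
    (ζ : ℂ) (w : V₁ × V₂) : ℝ :=
  Real.sqrt (‖ζ‖ ^ 2 * ‖w.1‖ ^ 2 + (‖ζ‖ ^ 2)⁻¹ * ‖w.2‖ ^ 2)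

/-- The extended `ℂ*`-action on the polar coordinates `(r, w) ∈ ℝ × S(V' ⊕ V'')` of the
spherical blowup: `ζ · (r, w) = (r N(ζ, w), N(ζ, w)⁻¹ (ζ w', ζ⁻¹ w''))`. -/
noncomputable def blowupAct {V₁ V₂ : Type*} [NormedAddCommGroup V₁] [InnerProductSpace ℂ V₁]
    [NormedAddCommGroup V₂] [InnerProductSpace ℂ V₂]
    (ζ : ℂ) (p : ℝ × (V₁ × V₂)) : ℝ × (V₁ × V₂) :=
  (p.1 * sphereN ζ p.2, (sphereN ζ p.2)⁻¹ • (ζ • p.2.1, ζ⁻¹ • p.2.2))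

/-- The formula `ζ · (r, w) = (r N(ζ, w), N(ζ, w)⁻¹ (ζ w', ζ⁻¹ w''))` defines an action of
`ℂ*` on `ℝ × S(V' ⊕ V'')`: the normalizing factor is positive, `1` acts as the identity, the
second component stays on the unit sphere, the action is compatible with multiplication in
`ℂ*`, and for `r > 0` it is intertwined with the action `ζ · (y', y'') = (ζ y', ζ⁻¹ y'')`
by the map `(r, (w', w'')) ↦ (r w', r w'')`. -/
theorem stmt_11 {V₁ V₂ : Type*} [NormedAddCommGroup V₁] [InnerProductSpace ℂ V₁]
    [NormedAddCommGroup V₂] [InnerProductSpace ℂ V₂] :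
    ∀ w : V₁ × V₂, ‖w.1‖ ^ 2 + ‖w.2‖ ^ 2 = 1 →
      (∀ ζ : ℂ, ζ ≠ 0 → 0 < sphereN ζ w) ∧
      (∀ r : ℝ, blowupAct 1 (r, w) = (r, w)) ∧
      (∀ ζ : ℂ, ζ ≠ 0 → ∀ r : ℝ,
        ‖(blowupAct ζ (r, w)).2.1‖ ^ 2 + ‖(blowupAct ζ (r, w)).2.2‖ ^ 2 = 1) ∧
      (∀ ζ₁ ζ₂ : ℂ, ζ₁ ≠ 0 → ζ₂ ≠ 0 → ∀ r : ℝ,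
        blowupAct ζ₁ (blowupAct ζ₂ (r, w)) = blowupAct (ζ₁ * ζ₂) (r, w)) ∧
      (∀ ζ : ℂ, ζ ≠ 0 → ∀ r : ℝ, 0 < r →
        ((blowupAct ζ (r, w)).1 • (blowupAct ζ (r, w)).2.1,
          (blowupAct ζ (r, w)).1 • (blowupAct ζ (r, w)).2.2) =
          (ζ • (r • w.1), ζ⁻¹ • (r • w.2))) := by
  intro w hw
  have hpos : ∀ ζ : ℂ, ζ ≠ 0 → 0 < sphereN ζ w := by
    intro ζ hζ
    have hz : 0 < ‖ζ‖ := norm_pos_iff.mpr hζ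
    apply Real.sqrt_pos.mpr
    by_cases h : ‖w.1‖ ^ 2 = 0
    · have h2 : ‖w.2‖ ^ 2 = 1 := by linarith
      rw [h, h2]
      positivity
    · have h1 : 0 < ‖w.1‖ ^ 2 := lt_of_le_of_ne (by positivity) (Ne.symm h)
      have h3 : 0 < ‖ζ‖ ^ 2 * ‖w.1‖ ^ 2 := by positivity
      have h4 : 0 ≤ (‖ζ‖ ^ 2)⁻¹ * ‖w.2‖ ^ 2 := by positivity
      linarith
  have hsq : ∀ ζ : ℂ, sphereN ζ w ^ 2 = ‖ζ‖ ^ 2 * ‖w.1‖ ^ 2 + (‖ζ‖ ^ 2)⁻¹ * ‖w.2‖ ^ 2 := by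
    intro ζ
    exact Real.sq_sqrt (by positivity)
  refine ⟨hpos, ?_, ?_, ?_, ?_⟩
  · intro r
    have h1 : sphereN 1 w = 1 := by simp [sphereN, hw]
    simp [blowupAct, h1]
  · intro ζ hζ r
    have hp := hpos ζ hζ
    have hs := hsq ζ
    simp only [blowupAct, Prod.smul_fst, Prod.smul_snd, norm_smul, norm_inv, Real.norm_eq_abs,
      abs_of_pos hp, mul_pow, inv_pow]
    rw [← mul_add, ← hs]
    exact inv_mul_cancel₀ (by positivity)
  · intro ζ₁ ζ₂ h₁ h₂ r
    have hp := hpos ζ₂ h₂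
    have hp' := hpos (ζ₁ * ζ₂) (mul_ne_zero h₁ h₂)
    have key : sphereN ζ₁ ((sphereN ζ₂ w)⁻¹ • (ζ₂ • w.1, ζ₂⁻¹ • w.2))
        = (sphereN ζ₂ w)⁻¹ * sphereN (ζ₁ * ζ₂) w := by
      rw [sphereN, Real.sqrt_eq_iff_mul_self_eq (by positivity) (by positivity), ← pow_two,
        mul_pow, hsq (ζ₁ * ζ₂)]
      simp only [Prod.smul_fst, Prod.smul_snd, norm_smul, norm_inv, Real.norm_eq_abs,
        abs_of_pos hp, mul_pow, inv_pow, norm_mul, mul_inv]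
      ring
    simp only [blowupAct, key]
    refine Prod.ext ?_ (Prod.ext ?_ ?_)
    · simp only
      field_simp
    · simp only [Prod.smul_fst]
      rw [smul_comm ζ₁ (sphereN ζ₂ w)⁻¹, smul_smul, smul_smul ζ₁ ζ₂]
      congr 1
      field_simp
    · simp only [Prod.smul_snd]
      rw [smul_comm ζ₁⁻¹ (sphereN ζ₂ w)⁻¹, smul_smul, smul_smul ζ₁⁻¹ ζ₂⁻¹, mul_inv ζ₁ ζ₂]
      congr 1
      field_simp
  · intro ζ hζ r hr
    have hp := hpos ζ hζ
    simp only [blowupAct, Prod.smul_fst, Prod.smul_snd, smul_smul, mul_assoc,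
      mul_inv_cancel₀ hp.ne', mul_one]
    rw [smul_comm ζ r, smul_comm ζ⁻¹ r]
end
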